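/- Assume Ψ satisfies the SOSC with feasible open set O, let s be the similarity dimension, let μ be the natural measure, and assume μ(∂O) = 0 (a known property of self-similar measures under the SOSC). Then for every finite word i over M and every closed ball B(x, d) ⊆ O with d > 0: θ_μ^s(f_i(x), r_i·d) = θ_μ^s(x, d); that is, the ball B(f_i(x), r_i·d) is μ-density equivalent to B(x, d). -/

import Mathlib

open MeasureTheory Filter Topology
open scoped ENNReal

noncomputable section

/-- `f` is a similarity of ratio `r`. -/
def IsSimilarityRatio {X : Type*} [MetricSpace X] (f : X → X) (r : ℝ) : Prop :=
  ∀ x y, dist (f x) (f y) = r * dist x y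

/-- The composition `f_{i₁} ∘ ⋯ ∘ f_{i_k}` associated with a finite word. -/
def wordMap {X : Type*} {m : ℕ} (f : Fin m → X → X) : List (Fin m) → X → X
  | [] => id
  | j :: l => f j ∘ wordMap f l

/-- The product `r_{i₁} ⋯ r_{i_k}` associated with a finite word. -/
def wordProd {m : ℕ} (p : Fin m → ℝ) (l : List (Fin m)) : ℝ := (l.map p).prod

/-- The `s`-density `θ_μ^s(x, d) = μ(B(x,d)) / (2d)^s` of the closed ball `B(x, d)`. -/
def sdens {n : ℕ} (μ : Measure (EuclideanSpace ℝ (Fin n))) (s : ℝ)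
    (x : EuclideanSpace ℝ (Fin n)) (d : ℝ) : ℝ≥0∞ :=
  μ (Metric.closedBall x d) / ENNReal.ofReal ((2 * d) ^ s)

namespace IsSimilarityRatio

theorem continuous {X : Type*} [MetricSpace X] {f : X → X} {r : ℝ} (hr : 0 ≤ r)
    (hf : IsSimilarityRatio f r) : Continuous f :=
  (LipschitzWith.of_dist_le_mul (K := ⟨r, hr⟩) fun x y => (hf x y).le).continuous

theorem preimage_closedBall {X : Type*} [MetricSpace X] {f : X → X} {r : ℝ} (hr : 0 < r)
    (hf : IsSimilarityRatio f r) (x : X) (d : ℝ) :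
    f ⁻¹' Metric.closedBall (f x) (r * d) = Metric.closedBall x d := by
  ext y
  simp only [Set.mem_preimage, Metric.mem_closedBall, hf y x]
  exact mul_le_mul_iff_right₀ hr

theorem surjective {V : Type*} [NormedAddCommGroup V] [InnerProductSpace ℝ V]
    [FiniteDimensional ℝ V] {f : V → V} {r : ℝ} (hr : 0 < r) (hf : IsSimilarityRatio f r) :
    Function.Surjective f := by
  have hg : Isometry fun x => r⁻¹ • f x := Isometry.of_dist_eq fun x y => by
    rw [dist_smul₀, hf x y, norm_inv, Real.norm_of_nonneg hr.le, inv_mul_cancel_left₀ hr.ne']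
  intro y
  have : Inhabited V := ⟨y⟩
  obtain ⟨x, hx⟩ :=
    (hg.affineIsometryOfStrictConvexSpace.toAffineIsometryEquiv rfl).surjective (r⁻¹ • y)
  exact ⟨x, smul_right_injective V (inv_ne_zero hr.ne') hx⟩

theorem image_closedBall {V : Type*} [NormedAddCommGroup V] [InnerProductSpace ℝ V]
    [FiniteDimensional ℝ V] {f : V → V} {r : ℝ} (hr : 0 < r) (hf : IsSimilarityRatio f r)
    (x : V) (d : ℝ) :
    f '' Metric.closedBall x d = Metric.closedBall (f x) (r * d) := by
  rw [← hf.preimage_closedBall hr, Set.image_preimage_eq _ (hf.surjective hr)]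

end IsSimilarityRatio

/-- A compact set covered by its images under contracting similarities lies in the closure of
every nonempty set that these similarities map into itself. -/
theorem subset_closure_of_subset_iUnion_image {X ι : Type*} [MetricSpace X] {f : ι → X → X}
    {r : ι → ℝ} (hr : ∀ i, r i ∈ Set.Ioo (0 : ℝ) 1) (hsim : ∀ i, IsSimilarityRatio (f i) (r i))
    {E O : Set X} (hE : IsCompact E) (hEsub : E ⊆ ⋃ i, f i '' E) (hO : O.Nonempty)
    (hOmap : ∀ i, f i '' O ⊆ O) : E ⊆ closure O := by
  intro e he
  obtain ⟨a, haE, hamax⟩ :=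
    hE.exists_isMaxOn ⟨e, he⟩ (Metric.continuous_infDist_pt O).continuousOn
  obtain ⟨i, b, hbE, rfl⟩ := Set.mem_iUnion.1 (hEsub haE)
  have hcontr : Metric.infDist (f i b) O ≤ r i * Metric.infDist b O := by
    rw [← div_le_iff₀' (hr i).1]
    refine (Metric.le_infDist hO).2 fun y hy => ?_
    rw [div_le_iff₀' (hr i).1, ← hsim i b y]
    exact Metric.infDist_le_dist_of_mem (hOmap i ⟨y, hy, rfl⟩)
  have hb : Metric.infDist b O ≤ Metric.infDist (f i b) O := hamax hbE
  have he' : Metric.infDist e O ≤ Metric.infDist (f i b) O := hamax he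
  rw [Metric.mem_closure_iff_infDist_zero hO]
  refine le_antisymm ?_ Metric.infDist_nonneg
  nlinarith [(hr i).1, (hr i).2, Metric.infDist_nonneg (x := b) (s := O)]

/-- A self-similar measure carried by `O` scales by `p j` on the image under `f j` of a subset of
`O`, if the images `f i '' O` are pairwise disjoint. -/
theorem measure_image_of_subset {X ι : Type*} [MeasurableSpace X] [Fintype ι]
    {f : ι → X → X} (hf : ∀ i, Measurable (f i)) {p : ι → ℝ≥0∞} {μ : Measure X}
    (hinv : μ = ∑ i, p i • μ.map (f i)) {O : Set X} (hO : μ Oᶜ = 0)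
    (hdisj : ∀ i j, i ≠ j → Disjoint (f i '' O) (f j '' O)) {j : ι}
    (hinj : Function.Injective (f j)) {B : Set X} (hB : B ⊆ O)
    (hmeas : MeasurableSet (f j '' B)) : μ (f j '' B) = p j * μ B := by
  conv_lhs => rw [hinv]
  simp only [Measure.coe_finsetSum, Measure.coe_smul, Finset.sum_apply, Pi.smul_apply, smul_eq_mul]
  rw [Finset.sum_eq_single j]
  · rw [Measure.map_apply (hf j) hmeas, Set.preimage_image_eq _ hinj]
  · intro i _ hij
    rw [Measure.map_apply (hf i) hmeas, measure_mono_null _ hO, mul_zero]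
    intro y hy hyO
    exact Set.disjoint_left.1 (hdisj i j hij) ⟨y, hyO, rfl⟩ (Set.image_mono hB hy)
  · simp

/-- The density is unchanged when radius and mass are scaled by `a` and `a ^ s`. -/
theorem sdens_eq_of_measure_eq {n : ℕ} {μ : Measure (EuclideanSpace ℝ (Fin n))} {s a d : ℝ}
    {x y : EuclideanSpace ℝ (Fin n)} (ha : 0 < a) (hd : 0 ≤ d)
    (h : μ (Metric.closedBall y (a * d)) = ENNReal.ofReal (a ^ s) * μ (Metric.closedBall x d)) :
    sdens μ s y (a * d) = sdens μ s x d := by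
  have hpow : (2 * (a * d)) ^ s = a ^ s * (2 * d) ^ s := by
    rw [← Real.mul_rpow ha.le (by positivity)]
    ring_nf
  rw [sdens, sdens, h, hpow, ENNReal.ofReal_mul (by positivity)]
  exact ENNReal.mul_div_mul_left _ _ (by simpa using Real.rpow_pos_of_pos ha s)
    ENNReal.ofReal_ne_top

theorem wordProd_cons {m : ℕ} (p : Fin m → ℝ) (j : Fin m) (l : List (Fin m)) :
    wordProd p (j :: l) = p j * wordProd p l := by
  simp [wordProd]

theorem wordProd_pos {m : ℕ} {p : Fin m → ℝ} (hp : ∀ i, 0 < p i) (l : List (Fin m)) :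
    0 < wordProd p l :=
  List.prod_pos fun _ ha => by
    obtain ⟨i, -, rfl⟩ := List.mem_map.1 ha
    exact hp i

/-- under the SOSC, for any word `i` and any closed ball `B(x,d) ⊆ O`,
`B(f_i(x), r_i d)` is `μ`-density equivalent to `B(x, d)` for the natural measure `μ`. -/
theorem stmt3 {n m : ℕ} (hn : 1 ≤ n) (hm : 2 ≤ m)
    (f : Fin m → EuclideanSpace ℝ (Fin n) → EuclideanSpace ℝ (Fin n))
    (r : Fin m → ℝ) (hr : ∀ i, r i ∈ Set.Ioo (0 : ℝ) 1)
    (hsim : ∀ i, IsSimilarityRatio (f i) (r i))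
    (E : Set (EuclideanSpace ℝ (Fin n))) (hEcomp : IsCompact E) (hEne : E.Nonempty)
    (hEattr : E = ⋃ i, f i '' E)
    (O : Set (EuclideanSpace ℝ (Fin n))) (hOopen : IsOpen O) (hOne : O.Nonempty)
    (hOmap : ∀ i, f i '' O ⊆ O)
    (hOdisj : ∀ i j, i ≠ j → Disjoint (f i '' O) (f j '' O))
    (hOE : (O ∩ E).Nonempty)
    (s : ℝ) (hs : ∑ i, (r i) ^ s = 1)
    (μ : Measure (EuclideanSpace ℝ (Fin n))) (hprob : IsProbabilityMeasure μ)
    (hsupp : μ Eᶜ = 0)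
    (hinv : μ = ∑ i, ENNReal.ofReal ((r i) ^ s) • μ.map (f i))
    (hfront : μ (frontier O) = 0) :
    ∀ (l : List (Fin m)) (x : EuclideanSpace ℝ (Fin n)) (d : ℝ), 0 < d →
      Metric.closedBall x d ⊆ O →
      sdens μ s (wordMap f l x) (wordProd r l * d) = sdens μ s x d := by
  intro l x d hd hball
  have hsub := subset_closure_of_subset_iUnion_image hr hsim hEcomp hEattr.subset hOne hOmap
  have hO : μ Oᶜ = 0 := by
    refine measure_mono_null (t := Eᶜ ∪ frontier O) (fun y hy => ?_)
      (measure_union_null hsupp hfront)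
    by_cases hyE : y ∈ E
    · exact Or.inr ⟨hsub hyE, by rwa [hOopen.interior_eq]⟩
    · exact Or.inl hyE
  suffices h : Metric.closedBall (wordMap f l x) (wordProd r l * d) ⊆ O ∧
      sdens μ s (wordMap f l x) (wordProd r l * d) = sdens μ s x d from h.2
  induction l with
  | nil => simpa [wordMap, wordProd] using hball
  | cons j l ih =>
    obtain ⟨ihO, ih⟩ := ih
    have himage := (hsim j).image_closedBall (hr j).1 (wordMap f l x) (wordProd r l * d)
    have hinj : Function.Injective (f j) := fun y z hyz => by
      have hdist := hsim j y z
      rw [hyz, dist_self, eq_comm, mul_eq_zero] at hdist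
      exact dist_eq_zero.1 (hdist.resolve_left (hr j).1.ne')
    have hpos := wordProd_pos (fun i => (hr i).1) l
    rw [wordProd_cons, mul_assoc, wordMap, Function.comp_apply]
    refine ⟨himage ▸ (Set.image_mono ihO).trans (hOmap j), ?_⟩
    rw [← ih]
    refine sdens_eq_of_measure_eq (hr j).1 (by positivity) ?_
    rw [← himage]
    exact measure_image_of_subset
      (fun i => ((hsim i).continuous (hr i).1.le).measurable)
      hinv hO hOdisj hinj ihO (himage ▸ Metric.isClosed_closedBall.measurableSet)
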